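/- arXiv:2112.06506 — 3 statements merged into one kernel-verified Lean document; each statement's English description precedes it below -/
import Mathlib

section
/- Every automorphism of the infinite grid graph is affine: for every grid automorphism φ there exist a 2×2 signed permutation matrix A and a vector b ∈ ℤ² such that φ(x) = A·x + b for all x ∈ ℤ²; conversely, every map of this form is a grid automorphism. -/
/-- Manhattan distance on the integer grid. -/
def mdist (u v : ℤ × ℤ) : ℤ := |u.1 - v.1| + |u.2 - v.2|

/-- Adjacency in the infinite grid graph. -/
def GridAdj (u v : ℤ × ℤ) : Prop := mdist u v = 1

/-- A grid automorphism: a bijection preserving adjacency in both directions. -/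
def GridAuto (φ : ℤ × ℤ → ℤ × ℤ) : Prop :=
  Function.Bijective φ ∧ ∀ u v, GridAdj u v ↔ GridAdj (φ u) (φ v)

/-- A 2×2 signed permutation matrix: entries in {-1,0,1}, exactly one nonzero
entry in each row and each column. -/
def IsSignedPerm (A : Matrix (Fin 2) (Fin 2) ℤ) : Prop :=
  (∀ i j, A i j = -1 ∨ A i j = 0 ∨ A i j = 1) ∧
  (∀ i, ∃! j, A i j ≠ 0) ∧ (∀ j, ∃! i, A i j ≠ 0)

/-- The affine map x ↦ A·x + b on ℤ². -/
def affZ (A : Matrix (Fin 2) (Fin 2) ℤ) (b : ℤ × ℤ) (x : ℤ × ℤ) : ℤ × ℤ :=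
  (A 0 0 * x.1 + A 0 1 * x.2 + b.1, A 1 0 * x.1 + A 1 1 * x.2 + b.2)

theorem gridAdj_iff (u v : ℤ × ℤ) : GridAdj u v ↔
    (u.1 = v.1 ∧ (u.2 = v.2 + 1 ∨ u.2 = v.2 - 1)) ∨
      (u.2 = v.2 ∧ (u.1 = v.1 + 1 ∨ u.1 = v.1 - 1)) := by
  unfold GridAdj mdist
  grind

theorem isSignedPerm_iff (A : Matrix (Fin 2) (Fin 2) ℤ) : IsSignedPerm A ↔
    (A 0 1 = 0 ∧ A 1 0 = 0 ∧ (A 0 0 = 1 ∨ A 0 0 = -1) ∧ (A 1 1 = 1 ∨ A 1 1 = -1)) ∨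
      (A 0 0 = 0 ∧ A 1 1 = 0 ∧ (A 0 1 = 1 ∨ A 0 1 = -1) ∧ (A 1 0 = 1 ∨ A 1 0 = -1)) := by
  simp only [IsSignedPerm, ExistsUnique, Fin.forall_fin_two, Fin.exists_fin_two]
  grind

theorem gridAuto_affZ {A : Matrix (Fin 2) (Fin 2) ℤ} (hA : IsSignedPerm A) (b : ℤ × ℤ) :
    GridAuto (affZ A b) := by
  have key := (isSignedPerm_iff A).1 hA
  refine ⟨⟨?_, ?_⟩, ?_⟩
  · rintro ⟨x, y⟩ ⟨z, w⟩ h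
    simp only [affZ, Prod.mk.injEq] at h ⊢
    rcases key with ⟨h1, h2, h3 | h3, h4 | h4⟩ | ⟨h1, h2, h3 | h3, h4 | h4⟩ <;>
      simp only [h1, h2, h3, h4] at h <;> omega
  · rintro ⟨x, y⟩
    refine ⟨(A 0 0 * (x - b.1) + A 1 0 * (y - b.2), A 0 1 * (x - b.1) + A 1 1 * (y - b.2)), ?_⟩
    simp only [affZ, Prod.mk.injEq]
    rcases key with ⟨h1, h2, h3 | h3, h4 | h4⟩ | ⟨h1, h2, h3 | h3, h4 | h4⟩ <;>
      simp only [h1, h2, h3, h4] <;> omega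
  · intro u v
    simp only [gridAdj_iff, affZ]
    rcases key with ⟨h1, h2, h3 | h3, h4 | h4⟩ | ⟨h1, h2, h3 | h3, h4 | h4⟩ <;>
      simp only [h1, h2, h3, h4] <;> omega

theorem eq_add_mul_of_add_eq_two_mul {f : ℤ → ℤ} (hf : ∀ n, f (n + 1) + f (n - 1) = 2 * f n)
    (n : ℤ) : f n = f 0 + n * (f 1 - f 0) := by
  suffices h : f n = f 0 + n * (f 1 - f 0) ∧ f (n + 1) = f 0 + (n + 1) * (f 1 - f 0) from h.1
  induction n using Int.induction_on with
  | zero => simp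
  | succ k ih =>
    have h := hf (k + 1)
    rw [add_sub_cancel_right] at h
    exact ⟨ih.2, by linear_combination h + 2 * ih.2 - ih.1⟩
  | pred k ih =>
    have h := hf (-k)
    rw [sub_add_cancel]
    exact ⟨by linear_combination h + 2 * ih.1 - ih.2, by linear_combination ih.1⟩

/-- If `p` is the only common neighbour of its neighbours `v` and `w`, then `p` is the midpoint
of `v` and `w`, since `v + w - p` is also a common neighbour. -/
theorem add_eq_two_mul_of_unique_common_neighbor {p v w : ℤ × ℤ} (hv : GridAdj v p)
    (hw : GridAdj w p) (h : ∀ q, GridAdj q v → GridAdj q w → q = p) :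
    v.1 + w.1 = 2 * p.1 ∧ v.2 + w.2 = 2 * p.2 := by
  have hq : v + w - p = p := by
    apply h <;>
      simp only [gridAdj_iff, Prod.fst_add, Prod.snd_add, Prod.fst_sub, Prod.snd_sub] at * <;>
      omega
  simp only [Prod.ext_iff, Prod.fst_add, Prod.snd_add, Prod.fst_sub, Prod.snd_sub] at hq
  omega

theorem GridAuto.add_eq_two_mul {φ : ℤ × ℤ → ℤ × ℤ} (hφ : GridAuto φ) {p v w : ℤ × ℤ}
    (hv : GridAdj v p) (hw : GridAdj w p) (h : ∀ q, GridAdj q v → GridAdj q w → q = p) :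
    (φ v).1 + (φ w).1 = 2 * (φ p).1 ∧ (φ v).2 + (φ w).2 = 2 * (φ p).2 := by
  refine add_eq_two_mul_of_unique_common_neighbor ((hφ.2 _ _).1 hv) ((hφ.2 _ _).1 hw) ?_
  intro q hqv hqw
  obtain ⟨r, rfl⟩ := hφ.1.2 q
  rw [h r ((hφ.2 _ _).2 hqv) ((hφ.2 _ _).2 hqw)]

theorem GridAuto.horizontal {φ : ℤ × ℤ → ℤ × ℤ} (hφ : GridAuto φ) (x y : ℤ) :
    (φ (x + 1, y)).1 + (φ (x - 1, y)).1 = 2 * (φ (x, y)).1 ∧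
      (φ (x + 1, y)).2 + (φ (x - 1, y)).2 = 2 * (φ (x, y)).2 := by
  apply hφ.add_eq_two_mul <;> grind [gridAdj_iff]

theorem GridAuto.vertical {φ : ℤ × ℤ → ℤ × ℤ} (hφ : GridAuto φ) (x y : ℤ) :
    (φ (x, y + 1)).1 + (φ (x, y - 1)).1 = 2 * (φ (x, y)).1 ∧
      (φ (x, y + 1)).2 + (φ (x, y - 1)).2 = 2 * (φ (x, y)).2 := by
  apply hφ.add_eq_two_mul <;> grind [gridAdj_iff]

/-- A function on `ℤ × ℤ` that is affine along every row and column, and whose horizontal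
increments are bounded by one, is affine. -/
theorem eq_affine_of_add_eq_two_mul {f : ℤ → ℤ → ℤ}
    (hx : ∀ x y, f (x + 1) y + f (x - 1) y = 2 * f x y)
    (hy : ∀ x y, f x (y + 1) + f x (y - 1) = 2 * f x y)
    (hb : ∀ y, |f 1 y - f 0 y| ≤ 1) (x y : ℤ) :
    f x y = (f 1 0 - f 0 0) * x + (f 0 1 - f 0 0) * y + f 0 0 := by
  have row := eq_add_mul_of_add_eq_two_mul (f := fun n ↦ f n y) (fun n ↦ hx n y) x
  have col (x y : ℤ) := eq_add_mul_of_add_eq_two_mul (f := f x) (hy x) y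
  have hd : f 1 1 - f 1 0 = f 0 1 - f 0 0 := by
    have h0 := abs_le.1 (hb 0)
    have h3 := abs_le.1 (hb 3)
    have c0 := col 0 3
    have c1 := col 1 3
    omega
  linear_combination row + (1 - x) * col 0 y + x * col 1 y + x * y * hd

theorem GridAuto.exists_eq_affZ {φ : ℤ × ℤ → ℤ × ℤ} (hφ : GridAuto φ) :
    ∃ (A : Matrix (Fin 2) (Fin 2) ℤ) (b : ℤ × ℤ), IsSignedPerm A ∧ ∀ x, φ x = affZ A b x := by
  have hinc (y : ℤ) : GridAdj (φ (1, y)) (φ (0, y)) := (hφ.2 _ _).1 (by simp [gridAdj_iff])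
  have hadj : GridAdj (φ (0, 1)) (φ (0, 0)) := (hφ.2 _ _).1 (by simp [gridAdj_iff])
  have hne : φ (0, 1) ≠ φ (1, 0) := hφ.1.1.ne (by simp)
  have hne' : φ (0, 1) ≠ φ (-1, 0) := hφ.1.1.ne (by simp)
  have hopp := hφ.horizontal 0 0
  have h1 := eq_affine_of_add_eq_two_mul (f := fun x y ↦ (φ (x, y)).1)
    (fun x y ↦ (hφ.horizontal x y).1) (fun x y ↦ (hφ.vertical x y).1)
    (fun y ↦ by have := (gridAdj_iff _ _).1 (hinc y); rw [abs_le]; omega)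
  have h2 := eq_affine_of_add_eq_two_mul (f := fun x y ↦ (φ (x, y)).2)
    (fun x y ↦ (hφ.horizontal x y).2) (fun x y ↦ (hφ.vertical x y).2)
    (fun y ↦ by have := (gridAdj_iff _ _).1 (hinc y); rw [abs_le]; omega)
  refine ⟨!![(φ (1, 0)).1 - (φ (0, 0)).1, (φ (0, 1)).1 - (φ (0, 0)).1;
    (φ (1, 0)).2 - (φ (0, 0)).2, (φ (0, 1)).2 - (φ (0, 0)).2], φ (0, 0), ?_,
    fun x ↦ Prod.ext (by simpa [affZ] using h1 x.1 x.2) (by simpa [affZ] using h2 x.1 x.2)⟩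
  have hinc0 := (gridAdj_iff _ _).1 (hinc 0)
  rw [gridAdj_iff] at hadj
  simp only [zero_add, zero_sub] at hopp
  simp only [ne_eq, Prod.ext_iff] at hne hne'
  simp only [isSignedPerm_iff, Matrix.of_apply, Matrix.cons_val', Matrix.cons_val_zero,
    Matrix.cons_val_one, Matrix.cons_val_fin_one]
  omega

/-- Every grid automorphism is affine with signed permutation linear part,
and conversely every such affine map is a grid automorphism. -/
theorem grid_auto_iff_affine (φ : ℤ × ℤ → ℤ × ℤ) :
    GridAuto φ ↔ ∃ (A : Matrix (Fin 2) (Fin 2) ℤ) (b : ℤ × ℤ),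
      IsSignedPerm A ∧ ∀ x, φ x = affZ A b x := by
  constructor
  · exact GridAuto.exists_eq_affZ
  · rintro ⟨A, b, hA, h⟩
    rw [funext h]
    exact gridAuto_affZ hA b
end

section
/- Impossibility of gathering outside the fixed nodes of a symmetry (fully synchronous version of the paper's Theorem 1): let (R₀, M) be a configuration and φ a grid automorphism with φ(M) = M and with the image multiset of R₀ under φ equal to R₀. Define the fully synchronous execution of an equivariant deterministic anonymous algorithm F by R_{t+1} = image multiset of R_t under v ↦ F(l_{R_t,M})(v). Then for every t, the image multiset of R_t under φ equals R_t; consequently, if at some round t all robots occupy a single node m (i.e., R_t consists of card(R₀) copies of m), then φ(m) = m. In particular, gathering is impossible at any node of a set on which φ is partitive (all orbits of size k > 1). -/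
/-- The label function of a configuration (R, M). -/
def label (R : Multiset (ℤ × ℤ)) (M : Finset (ℤ × ℤ)) (v : ℤ × ℤ) : Fin 6 :=
  if v ∈ M then
    (if R.count v = 0 then 1 else if R.count v = 1 then 2 else 3)
  else
    (if R.count v = 0 then 0 else if R.count v = 1 then 4 else 5)

/-- An equivariant deterministic anonymous algorithm. -/
def Equivariant (F : ((ℤ × ℤ) → Fin 6) → (ℤ × ℤ) → ℤ × ℤ) : Prop :=
  ∀ ψ : (ℤ × ℤ) ≃ (ℤ × ℤ), GridAuto ⇑ψ →
    ∀ (l : (ℤ × ℤ) → Fin 6) (v : ℤ × ℤ), F (l ∘ ⇑ψ.symm) (ψ v) = ψ (F l v)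

/-- The fully synchronous execution of algorithm F from initial robot multiset R0. -/
def execF (F : ((ℤ × ℤ) → Fin 6) → (ℤ × ℤ) → ℤ × ℤ) (M : Finset (ℤ × ℤ))
    (R0 : Multiset (ℤ × ℤ)) : ℕ → Multiset (ℤ × ℤ)
  | 0 => R0
  | t + 1 => (execF F M R0 t).map (F (label (execF F M R0 t) M))

theorem label_comp_symm {R : Multiset (ℤ × ℤ)} {M : Finset (ℤ × ℤ)} (φ : (ℤ × ℤ) ≃ (ℤ × ℤ))
    (hM : M.image ⇑φ = M) (hR : R.map ⇑φ = R) : label R M ∘ ⇑φ.symm = label R M := by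
  funext v
  have hmem : φ.symm v ∈ M ↔ v ∈ M := by
    conv_rhs => rw [← hM, ← φ.apply_symm_apply v]
    rw [φ.injective.mem_finset_image]
  have hcount : R.count (φ.symm v) = R.count v := by
    conv_rhs => rw [← hR, ← φ.apply_symm_apply v]
    rw [Multiset.count_map_eq_count' _ _ φ.injective]
  simp only [Function.comp_apply, label, hmem, hcount]

theorem execF_map_eq_self {R0 : Multiset (ℤ × ℤ)} {M : Finset (ℤ × ℤ)} {φ : (ℤ × ℤ) ≃ (ℤ × ℤ)}
    (hφ : GridAuto ⇑φ) (hM : M.image ⇑φ = M) (hR : R0.map ⇑φ = R0)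
    {F : ((ℤ × ℤ) → Fin 6) → (ℤ × ℤ) → ℤ × ℤ} (hF : Equivariant F) (t : ℕ) :
    (execF F M R0 t).map ⇑φ = execF F M R0 t := by
  induction t with
  | zero => exact hR
  | succ t ih =>
    have hcomm (v : ℤ × ℤ) : φ (F (label (execF F M R0 t) M) v) =
        F (label (execF F M R0 t) M) (φ v) := by
      rw [← hF φ hφ, label_comp_symm φ hM ih]
    calc (execF F M R0 (t + 1)).map ⇑φ
        = ((execF F M R0 t).map ⇑φ).map (F (label (execF F M R0 t) M)) := by
          simp only [execF, Multiset.map_map, Function.comp_def, hcomm]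
      _ = execF F M R0 (t + 1) := by rw [ih, execF]

theorem apply_eq_of_map_replicate_eq {α : Type*} {f : α → α} {n : ℕ} {m : α} (hn : n ≠ 0)
    (h : (Multiset.replicate n m).map f = Multiset.replicate n m) : f m = m := by
  rw [Multiset.map_replicate] at h
  exact Multiset.replicate_right_injective hn h

/-- Impossibility of gathering outside the fixed nodes of a symmetry: every
round of the fully synchronous execution stays φ-symmetric; hence if gathering
is achieved at a node m, then φ(m) = m. In particular, gathering is impossible
at any node of a set on which φ is partitive. -/
theorem gathering_only_at_fixed_nodes (R0 : Multiset (ℤ × ℤ)) (hR0 : R0 ≠ 0)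
    (M : Finset (ℤ × ℤ)) (φ : (ℤ × ℤ) ≃ (ℤ × ℤ)) (hφ : GridAuto ⇑φ)
    (hM : M.image ⇑φ = M) (hR : R0.map ⇑φ = R0)
    (F : ((ℤ × ℤ) → Fin 6) → (ℤ × ℤ) → ℤ × ℤ) (hF : Equivariant F) :
    (∀ t : ℕ, (execF F M R0 t).map ⇑φ = execF F M R0 t) ∧
    (∀ (t : ℕ) (m : ℤ × ℤ),
      execF F M R0 t = Multiset.replicate (Multiset.card R0) m → φ m = m) ∧
    (∀ (t : ℕ) (m : ℤ × ℤ),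
      execF F M R0 t = Multiset.replicate (Multiset.card R0) m →
      ∀ (V'' : Set (ℤ × ℤ)) (k : ℕ), 1 < k →
        (∀ x ∈ V'', Nat.card {y : ℤ × ℤ | ∃ n : ℕ, (⇑φ)^[n] x = y} = k) →
        m ∉ V'') := by
  have hsymm := execF_map_eq_self hφ hM hR hF
  have hfix (t : ℕ) (m : ℤ × ℤ)
      (h : execF F M R0 t = Multiset.replicate (Multiset.card R0) m) : φ m = m :=
    apply_eq_of_map_replicate_eq (mt Multiset.card_eq_zero.mp hR0) (h ▸ hsymm t)
  refine ⟨hsymm, hfix, fun t m h V k hk hV hm => ?_⟩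
  have horbit : {y : ℤ × ℤ | ∃ n : ℕ, (⇑φ)^[n] m = y} = {m} := by
    ext y
    simp [Function.iterate_fixed (hfix t m h), eq_comm]
  have hcard := hV m hm
  rw [horbit, Nat.card_unique] at hcard
  exact hk.ne hcard
end

section
/- Lower-bound instance (core of the paper's Theorem 3, that any gathering algorithm requires Ω(Dn) moves): place n robots at the nodes (1,0), (2,0), …, (n,0) and a single meeting node at (0,0). Then any sequence of single-robot moves along grid edges that transforms this configuration into the configuration with all n robots at (0,0) has length at least 1 + 2 + ⋯ + n = n(n+1)/2; in particular, for this family of configurations the larger side D of the minimum enclosing rectangle equals n, and the number of required moves is Ω(Dn). -/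
/-- If two families of grid positions agree outside index `i`, and their `i`-th entries are equal or
adjacent, then passing from `p` to `q` lowers the sum of the absolute values of the first coordinates
by at most one. -/
theorem sum_abs_fst_le_of_step {ι : Type*} [Fintype ι] {p q : ι → ℤ × ℤ} {i : ι}
    (hne : ∀ j, j ≠ i → q j = p j) (hi : q i = p i ∨ mdist (q i) (p i) = 1) :
    ∑ j, |(p j).1| ≤ ∑ j, |(q j).1| + 1 := by
  classical
  have key : |(p i).1| ≤ |(q i).1| + 1 := by
    rcases hi with h | h
    · rw [h]; lia
    · unfold mdist at h; grind
  rw [← Finset.add_sum_erase _ _ (Finset.mem_univ i),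
    ← Finset.add_sum_erase Finset.univ (fun j => |(q j).1|) (Finset.mem_univ i),
    Finset.sum_congr rfl fun j hj => by rw [← hne j (Finset.ne_of_mem_erase hj)]]
  linarith

/-- Twice the sum of the first `n` positive integers is `n * (n + 1)`. -/
theorem two_mul_sum_fin_add_one (n : ℕ) :
    2 * ∑ i : Fin n, (((i : ℕ) : ℤ) + 1) = n * (n + 1) := by
  induction n with
  | zero => simp
  | succ n ih =>
    rw [Fin.sum_univ_castSucc, mul_add]
    simp only [Fin.val_castSucc, Fin.val_last, ih]
    push_cast
    ring

/-- Lower-bound instance: n robots at (1,0), …, (n,0) and one meeting node at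
(0,0); any sequence of single-robot moves along grid edges gathering all robots
at (0,0) has length at least 1 + 2 + ⋯ + n = n(n+1)/2.  For this family the
larger side of the minimum enclosing rectangle is D = n, so the number of
required moves is Ω(Dn). -/
theorem gathering_lower_bound_instance (n T : ℕ) (c : ℕ → Fin n → ℤ × ℤ)
    (h0 : ∀ i : Fin n, c 0 i = (((i : ℕ) : ℤ) + 1, 0))
    (hT : ∀ i : Fin n, c T i = (0, 0))
    (hstep : ∀ t < T, ∃ i : Fin n,
      (∀ j : Fin n, j ≠ i → c (t + 1) j = c t j) ∧
      (c (t + 1) i = c t i ∨ mdist (c (t + 1) i) (c t i) = 1)) :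
    ((n : ℤ) * ((n : ℤ) + 1)) / 2 ≤ (T : ℤ) := by
  have potential : ∀ t ≤ T, ∑ i, |(c 0 i).1| ≤ ∑ i, |(c t i).1| + t := by
    intro t
    induction t with
    | zero => simp
    | succ t ih =>
      intro ht
      obtain ⟨i, hne, hi⟩ := hstep t ht
      have := sum_abs_fst_le_of_step hne hi
      have := ih (Nat.le_of_succ_le ht)
      push_cast
      linarith
  have hinit : ∑ i, |(c 0 i).1| = ∑ i : Fin n, (((i : ℕ) : ℤ) + 1) :=
    Finset.sum_congr rfl fun i _ => by rw [h0]; exact abs_of_nonneg (by positivity)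
  have hfinal : ∑ i, |(c T i).1| = 0 := by simp [hT]
  have := potential T le_rfl
  have := two_mul_sum_fin_add_one n
  lia
end
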